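/- On 𝔤 = (0,0,0,12,0,0) (so de⁴ = e¹∧e², all other de^i = 0), let g = Σᵢ gᵢᵢ (e^i)² be a diagonal positive definite metric and B = e¹∧e⁴ + e²∧e³ + e⁵∧e⁶. Then B is closed and nondegenerate (symplectic), and its T-dual under the self-T-duality with 2-dimensional fiber ⟨e₅,e₆⟩ is B̃ = e¹∧e⁴ + e²∧e³ - (1/(g₅₅g₆₆+1)) e⁵∧e⁶ (up to the stated sign/normalization with b₅₆ = 1), which is again closed and nondegenerate; hence (g̃, B̃) is an emergent gravity. -/

import Mathlib

open Matrix

theorem kt_det (s t : ℝ) (hs : s ≠ 0) (ht : t ≠ 0) :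
    (!![0, 0, 0, 1, 0, 0;
         0, 0, 1, 0, 0, 0;
         0, -1, 0, 0, 0, 0;
         -1, 0, 0, 0, 0, 0;
         0, 0, 0, 0, 0, s;
         0, 0, 0, 0, t, 0] : Matrix (Fin 6) (Fin 6) ℝ).det ≠ 0 := by
  apply Matrix.det_ne_zero_of_right_inverse (B := !![0, 0, 0, -1, 0, 0;
         0, 0, -1, 0, 0, 0;
         0, 1, 0, 0, 0, 0;
         1, 0, 0, 0, 0, 0;
         0, 0, 0, 0, 0, t⁻¹;
         0, 0, 0, 0, s⁻¹, 0])
  ext i j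
  fin_cases i <;> fin_cases j <;> simp [Matrix.mul_apply, Fin.sum_univ_six, hs, ht]

theorem kt_closed (s t : ℝ) (x y z : Fin 6 → ℝ) :
    let bracket : (Fin 6 → ℝ) → (Fin 6 → ℝ) → (Fin 6 → ℝ) := fun x y =>
      ![0, 0, 0, -(x 0 * y 1 - x 1 * y 0), 0, 0]
    let B : Matrix (Fin 6) (Fin 6) ℝ :=
      !![0, 0, 0, 1, 0, 0;
         0, 0, 1, 0, 0, 0;
         0, -1, 0, 0, 0, 0;
         -1, 0, 0, 0, 0, 0;
         0, 0, 0, 0, 0, s;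
         0, 0, 0, 0, t, 0]
    (bracket x y) ⬝ᵥ B.mulVec z + (bracket y z) ⬝ᵥ B.mulVec x +
          (bracket z x) ⬝ᵥ B.mulVec y = 0 := by
  simp [dotProduct, Matrix.mulVec, Fin.sum_univ_six]
  ring

/-- On 𝔤 = (0,0,0,12,0,0) (Kodaira–Thurston × abelian), with diagonal positive
definite metric, the symplectic form B = e¹∧e⁴ + e²∧e³ + e⁵∧e⁶ is closed and
nondegenerate, its T-dual fiber part is given by the Cavalcanti–Gualtieri
formula with coefficient -1/(g₅₅g₆₆+1), and the dual form
B̃ = e¹∧e⁴ + e²∧e³ - (1/(g₅₅g₆₆+1)) e⁵∧e⁶ is again closed and nondegenerate. -/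
theorem Tdual_emergent_gravity_kt_times_T2 (d : Fin 6 → ℝ) (hd : ∀ i, 0 < d i) :
    let bracket : (Fin 6 → ℝ) → (Fin 6 → ℝ) → (Fin 6 → ℝ) := fun x y =>
      ![0, 0, 0, -(x 0 * y 1 - x 1 * y 0), 0, 0]
    let B : Matrix (Fin 6) (Fin 6) ℝ :=
      !![0, 0, 0, 1, 0, 0;
         0, 0, 1, 0, 0, 0;
         0, -1, 0, 0, 0, 0;
         -1, 0, 0, 0, 0, 0;
         0, 0, 0, 0, 0, 1;
         0, 0, 0, 0, -1, 0]
    let c : ℝ := 1 / (d 4 * d 5 + 1)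
    let Bt : Matrix (Fin 6) (Fin 6) ℝ :=
      !![0, 0, 0, 1, 0, 0;
         0, 0, 1, 0, 0, 0;
         0, -1, 0, 0, 0, 0;
         -1, 0, 0, 0, 0, 0;
         0, 0, 0, 0, 0, -c;
         0, 0, 0, 0, c, 0]
    let gf : Matrix (Fin 2) (Fin 2) ℝ := !![d 4, 0; 0, d 5]
    let Bf : Matrix (Fin 2) (Fin 2) ℝ := !![0, 1; -1, 0]
    ((∀ x y z : Fin 6 → ℝ,
        (bracket x y) ⬝ᵥ B.mulVec z + (bracket y z) ⬝ᵥ B.mulVec x +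
          (bracket z x) ⬝ᵥ B.mulVec y = 0) ∧
      B.det ≠ 0 ∧
      -(gf⁻¹ * Bf * (gf - Bf * gf⁻¹ * Bf)⁻¹) = (!![0, -c; c, 0] : Matrix (Fin 2) (Fin 2) ℝ) ∧
      (∀ x y z : Fin 6 → ℝ,
        (bracket x y) ⬝ᵥ Bt.mulVec z + (bracket y z) ⬝ᵥ Bt.mulVec x +
          (bracket z x) ⬝ᵥ Bt.mulVec y = 0) ∧
      Bt.det ≠ 0) := by
  intro bracket B c Bt gf Bf
  have ha := hd 4
  have hb := hd 5
  have hab : d 4 * d 5 + 1 ≠ 0 := by positivity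
  have hc : c ≠ 0 := one_div_ne_zero hab
  refine ⟨kt_closed 1 (-1), kt_det 1 (-1) one_ne_zero (by norm_num), ?_,
    kt_closed (-c) c, kt_det (-c) c (neg_ne_zero.mpr hc) hc⟩
  have h1 : gf⁻¹ = !![(d 4)⁻¹, 0; 0, (d 5)⁻¹] := by
    apply Matrix.inv_eq_right_inv
    ext i j
    fin_cases i <;> fin_cases j <;> simp [gf, Matrix.mul_apply, Fin.sum_univ_two, ha.ne', hb.ne']
  have h2 : (gf - Bf * gf⁻¹ * Bf)⁻¹ = !![d 5 * c, 0; 0, d 4 * c] := by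
    rw [h1]
    apply Matrix.inv_eq_right_inv
    ext i j
    fin_cases i <;> fin_cases j <;> simp [gf, Bf, c, Matrix.mul_apply, Fin.sum_univ_two] <;> field_simp
    all_goals ring
  rw [h2, h1]
  ext i j
  fin_cases i <;> fin_cases j <;> simp [Bf, Matrix.mul_apply, Fin.sum_univ_two] <;> field_simp
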